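/- arXiv:2107.09658 — 3 statements merged into one kernel-verified Lean document; each statement's English description precedes it below -/
import Mathlib

section
/- Let S ≤ S' be additive submonoids of ℕ with S ≠ S' and the pair (S, S') equi-gcd. Let n := Nat.card (PF(S'/S)) (the Cohen–Macaulay type) and n' := Nat.card (F(S'/S)) (the Frobenius type). Then Nat.card (N(S'/S)) ≤ n' * Nat.card (G(S'/S)) and Nat.card (G(S'/S)) ≤ n * Nat.card (N(S'/S)). -/
/-- The pair `(S, S')` is equi-gcd: a natural number divides every element of `S`
iff it divides every element of `S'`. -/
def EquiGcd (S S' : AddSubmonoid ℕ) : Prop :=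
  ∀ d : ℕ, (∀ x ∈ S, d ∣ x) ↔ (∀ x ∈ S', d ∣ x)

/-- The gap set `G(S'/S) = S' \ S`. -/
def gapSet (S S' : AddSubmonoid ℕ) : Set ℕ := (S' : Set ℕ) \ (S : Set ℕ)

/-- The sporadic set `N(S'/S)` of elements of `S` not in the conductor. -/
def sporadicSet (S S' : AddSubmonoid ℕ) : Set ℕ :=
  {a : ℕ | a ∈ S ∧ ∃ t ∈ S', a + t ∉ S}

/-- The pseudo-Frobenius set `PF(S'/S)`. -/
def pseudoFrobSet (S S' : AddSubmonoid ℕ) : Set ℕ :=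
  {w : ℕ | w ∈ S' ∧ w ∉ S ∧ ∀ s ∈ S, s ≠ 0 → w + s ∈ S}

/-- The Frobenius set `F(S'/S)`. -/
def frobSet (S S' : AddSubmonoid ℕ) : Set ℕ :=
  {w : ℕ | w ∈ S' ∧ w ∉ S ∧ ∀ t ∈ S', t ≠ 0 → w + t ∈ S}

/-- `S` is irreducible in `S'`. -/
def IrreducibleIn (S S' : AddSubmonoid ℕ) : Prop :=
  ∀ T₁ T₂ : AddSubmonoid ℕ, S ≤ T₁ → T₁ ≤ S' → S ≤ T₂ → T₂ ≤ S' →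
    T₁ ⊓ T₂ = S → T₁ = S ∨ T₂ = S

/-- The fundamental gap set `FG(S'/S)`. -/
def fundGapSet (S S' : AddSubmonoid ℕ) : Set ℕ :=
  {t : ℕ | t ∈ S' ∧ t ∉ S ∧ 2 * t ∈ S ∧ 3 * t ∈ S}

/-- The gap set of an equi-gcd pair is finite. -/
theorem EquiGcd.gapSet_finite {S S' : AddSubmonoid ℕ} (hgcd : EquiGcd S S') :
    (gapSet S S').Finite := by
  obtain ⟨n, hn⟩ := Nat.exists_mem_closure_of_ge (S : Set ℕ)
  refine (Set.finite_lt_nat n).subset fun m hm => ?_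
  by_contra hlt
  refine hm.2 ?_
  have hdvd : Nat.setGcd (S : Set ℕ) ∣ m :=
    (hgcd _).1 (fun x hx => Nat.setGcd_dvd_of_mem hx) m hm.1
  simpa using hn m (not_lt.1 hlt) hdvd

/-- If the gap set is finite, then translating some element of `S'` by an element of a
submonoid `T ≤ S'` that is maximal with the result outside `S` gives an element of `S' \ S`
all of whose nontrivial `T`-translates lie in `S`. -/
theorem exists_add_mem_gapSet_maximal {S S' T : AddSubmonoid ℕ} (hT : T ≤ S')
    (hfin : (gapSet S S').Finite) {x t : ℕ} (hx : x ∈ S') (ht : t ∈ T) (hxt : x + t ∉ S) :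
    ∃ u ∈ T, x + u ∈ S' ∧ x + u ∉ S ∧ ∀ v ∈ T, v ≠ 0 → x + u + v ∈ S := by
  have hA : {u | u ∈ T ∧ x + u ∉ S}.Finite :=
    Set.Finite.of_finite_image
      (hfin.subset (by rintro _ ⟨u, hu, rfl⟩; exact ⟨add_mem hx (hT hu.1), hu.2⟩))
      (add_right_injective x).injOn
  obtain ⟨u, hu⟩ := hA.exists_maximal ⟨t, ht, hxt⟩
  refine ⟨u, hu.prop.1, add_mem hx (hT hu.prop.1), hu.prop.2, fun v hv hv0 => ?_⟩
  by_contra hv'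
  have := hu.le_of_ge (y := u + v) ⟨add_mem hu.prop.1 hv, by rwa [← add_assoc]⟩ (by omega)
  omega

/-- A set of naturals embeds in `B × C` if each of its elements can be completed by an element
of `C` to a sum lying in `B`. -/
theorem Nat.card_le_mul_of_exists_add_mem {A B C : Set ℕ} (hB : B.Finite) (hC : C.Finite)
    (h : ∀ a ∈ A, ∃ c ∈ C, a + c ∈ B) : Nat.card A ≤ Nat.card B * Nat.card C := by
  choose f hfC hfB using h
  have := hB.to_subtype
  have := hC.to_subtype
  rw [← Nat.card_prod]
  refine Nat.card_le_card_of_injective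
    (fun a : A => ((⟨_, hfB a a.2⟩, ⟨_, hfC a a.2⟩) : B × C)) fun a b hab => ?_
  simp only [Prod.mk.injEq, Subtype.mk.injEq] at hab
  exact Subtype.ext (by omega)


theorem card_bounds (S S' : AddSubmonoid ℕ) (hSS' : S ≤ S') (hne : S ≠ S')
    (hgcd : EquiGcd S S') :
    Nat.card (sporadicSet S S') ≤ Nat.card (frobSet S S') * Nat.card (gapSet S S') ∧
    Nat.card (gapSet S S') ≤ Nat.card (pseudoFrobSet S S') * Nat.card (sporadicSet S S') := by
  have hG := hgcd.gapSet_finite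
  have hF : (frobSet S S').Finite := hG.subset fun w hw => ⟨hw.1, hw.2.1⟩
  have hPF : (pseudoFrobSet S S').Finite := hG.subset fun w hw => ⟨hw.1, hw.2.1⟩
  have hN : (sporadicSet S S').Finite := by
    obtain ⟨b, hb⟩ := hG.bddAbove
    refine (Set.finite_le_nat b).subset ?_
    rintro a ⟨ha, t, ht, hat⟩
    exact (Nat.le_add_right a t).trans (hb ⟨add_mem (hSS' ha) ht, hat⟩)
  constructor
  · refine Nat.card_le_mul_of_exists_add_mem hF hG ?_
    rintro a ⟨ha, t, ht, hat⟩
    obtain ⟨u, hu, hw⟩ := exists_add_mem_gapSet_maximal le_rfl hG (hSS' ha) ht hat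
    exact ⟨u, ⟨hu, fun huS => hw.2.1 (add_mem ha huS)⟩, hw⟩
  · refine Nat.card_le_mul_of_exists_add_mem hPF hN ?_
    rintro g ⟨hg, hgS⟩
    obtain ⟨u, hu, hw⟩ :=
      exists_add_mem_gapSet_maximal hSS' hG hg (zero_mem S) (by simpa using hgS)
    exact ⟨u, ⟨hu, g, hg, by rw [add_comm]; exact hw.2.1⟩, hw⟩
end

section
/- Let S ≤ S' be additive submonoids of ℕ with S ≠ S' and the pair (S, S') equi-gcd. Then S is irreducible in S' if and only if either PF(S'/S) = {w} for some w, or PF(S'/S) = {v, 2*v} for some v with v ≠ 2*v (i.e. PF(S'/S) = {w, w/2} for some even gap w). -/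
theorem EquiGcd.finite_gapSet {S S' : AddSubmonoid ℕ} (h : EquiGcd S S') :
    (gapSet S S').Finite := by
  obtain ⟨n, hn⟩ := Nat.exists_mem_closure_of_ge (S : Set ℕ)
  refine (Set.finite_lt_nat n).subset fun t ht => ?_
  by_contra! hlt
  refine ht.2 ?_
  have hdvd : Nat.setGcd (S : Set ℕ) ∣ t :=
    (h _).1 (fun x hx => Nat.setGcd_dvd_of_mem hx) t ht.1
  simpa using hn t (not_lt.1 hlt) hdvd

theorem EquiGcd.exists_pseudoFrob_mem {S S' T : AddSubmonoid ℕ} (h : EquiGcd S S')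
    (hST : S ≤ T) (hTS' : T ≤ S') (hne : T ≠ S) :
    ∃ m ∈ pseudoFrobSet S S', m ∈ T ∧ 2 * m ∈ S := by
  have hfin : (gapSet S T).Finite :=
    h.finite_gapSet.subset fun t ht => ⟨hTS' ht.1, ht.2⟩
  have hnon : (gapSet S T).Nonempty :=
    Set.sdiff_nonempty.2 fun hle => hne (le_antisymm hle hST)
  obtain ⟨m, ⟨hmT, hmS⟩, hmax⟩ := Set.exists_max_image _ id hfin hnon
  have hm0 : m ≠ 0 := by
    rintro rfl
    exact hmS S.zero_mem
  have key : ∀ t ∈ T, t ≠ 0 → m + t ∈ S := by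
    intro t ht ht0
    by_contra hts
    have : m + t ≤ m := hmax (m + t) ⟨T.add_mem hmT ht, hts⟩
    omega
  refine ⟨m, ⟨hTS' hmT, hmS, fun s hs => key s (hST hs)⟩, hmT, ?_⟩
  rw [two_mul]
  exact key m hmT hm0

theorem ne_zero_of_mem_pseudoFrobSet {S S' : AddSubmonoid ℕ} {m : ℕ}
    (hm : m ∈ pseudoFrobSet S S') : m ≠ 0 := by
  rintro rfl
  exact hm.2.1 S.zero_mem

theorem add_mem_pseudoFrobSet {S S' : AddSubmonoid ℕ} {v w : ℕ}
    (hv : v ∈ pseudoFrobSet S S') (hw : w ∈ pseudoFrobSet S S') (hvw : v + w ∉ S) :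
    v + w ∈ pseudoFrobSet S S' := by
  refine ⟨S'.add_mem hv.1 hw.1, hvw, fun s hs hs0 => ?_⟩
  rw [add_assoc]
  exact hv.2.2 _ (hw.2.2 s hs hs0) (by omega)

/-- The submonoid `S ∪ {m}` obtained by adjoining a pseudo-Frobenius element whose double
lies in `S`. -/
def adjoinPseudoFrob {S S' : AddSubmonoid ℕ} {m : ℕ} (hm : m ∈ pseudoFrobSet S S')
    (h2m : 2 * m ∈ S) : AddSubmonoid ℕ where
  carrier := insert m (S : Set ℕ)
  zero_mem' := Or.inr S.zero_mem
  add_mem' := by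
    have hadd : ∀ s ∈ S, m + s ∈ insert m (S : Set ℕ) := by
      intro s hs
      by_cases hs0 : s = 0
      · exact Or.inl (by simp [hs0])
      · exact Or.inr (hm.2.2 s hs hs0)
    rintro a b (rfl | ha) (rfl | hb)
    · exact Or.inr (by simpa [two_mul] using h2m)
    · exact hadd b hb
    · rw [add_comm]
      exact hadd a ha
    · exact Or.inr (S.add_mem ha hb)

theorem mem_adjoinPseudoFrob {S S' : AddSubmonoid ℕ} {m x : ℕ} (hm : m ∈ pseudoFrobSet S S')
    (h2m : 2 * m ∈ S) : x ∈ adjoinPseudoFrob hm h2m ↔ x = m ∨ x ∈ S :=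
  Iff.rfl

theorem irreducibleIn_iff_existsUnique {S S' : AddSubmonoid ℕ} (hSS' : S ≤ S')
    (hne : S ≠ S') (hgcd : EquiGcd S S') :
    IrreducibleIn S S' ↔ ∃! m, m ∈ pseudoFrobSet S S' ∧ 2 * m ∈ S := by
  constructor
  · intro hirr
    obtain ⟨m, hm, -, h2m⟩ := hgcd.exists_pseudoFrob_mem hSS' le_rfl hne.symm
    refine ⟨m, ⟨hm, h2m⟩, ?_⟩
    rintro k ⟨hk, h2k⟩
    by_contra hkm
    have hle : ∀ {x : ℕ} (hx : x ∈ pseudoFrobSet S S') (h2x : 2 * x ∈ S),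
        adjoinPseudoFrob hx h2x ≤ S' := by
      rintro x hx h2x y (rfl | hy)
      · exact hx.1
      · exact hSS' hy
    have hself : ∀ {x : ℕ} (hx : x ∈ pseudoFrobSet S S') (h2x : 2 * x ∈ S),
        adjoinPseudoFrob hx h2x ≠ S := fun hx h2x heq =>
      hx.2.1 (heq ▸ (mem_adjoinPseudoFrob hx h2x).2 (Or.inl rfl))
    have hinf : adjoinPseudoFrob hm h2m ⊓ adjoinPseudoFrob hk h2k = S := by
      ext x
      simp only [AddSubmonoid.mem_inf, mem_adjoinPseudoFrob]
      grind
    exact (hirr _ _ (fun _ => Or.inr) (hle hm h2m) (fun _ => Or.inr) (hle hk h2k) hinf).elim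
      (hself hm h2m) (hself hk h2k)
  · rintro ⟨m, ⟨hm, -⟩, huniq⟩ T₁ T₂ h₁ h₁' h₂ h₂' hinf
    by_contra! hT
    obtain ⟨a, ha, haT, h2a⟩ := hgcd.exists_pseudoFrob_mem h₁ h₁' hT.1
    obtain ⟨b, hb, hbT, h2b⟩ := hgcd.exists_pseudoFrob_mem h₂ h₂' hT.2
    obtain rfl := huniq a ⟨ha, h2a⟩
    obtain rfl := huniq b ⟨hb, h2b⟩
    exact ha.2.1 (hinf ▸ AddSubmonoid.mem_inf.2 ⟨haT, hbT⟩)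

theorem EquiGcd.exists_two_pow_mul_eq {S S' : AddSubmonoid ℕ} (h : EquiGcd S S') {m v : ℕ}
    (huniq : ∀ k, k ∈ pseudoFrobSet S S' ∧ 2 * k ∈ S → k = m)
    (hv : v ∈ pseudoFrobSet S S') : ∃ k : ℕ, 2 ^ k * v = m := by
  by_contra! hvm
  let A : Set ℕ := {x | x ∈ pseudoFrobSet S S' ∧ ∀ k : ℕ, 2 ^ k * x ≠ m}
  have hfin : A.Finite := h.finite_gapSet.subset fun x hx => ⟨hx.1.1, hx.1.2.1⟩
  obtain ⟨x, ⟨hx, hxm⟩, hmax⟩ := Set.exists_max_image A id hfin ⟨v, hv, hvm⟩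
  have h2x : 2 * x ∉ S := fun h2x => hxm 0 (by simpa using huniq x ⟨hx, h2x⟩)
  have hmem : 2 * x ∈ A := by
    refine ⟨?_, fun k => ?_⟩
    · rw [two_mul] at h2x ⊢
      exact add_mem_pseudoFrobSet hx hx h2x
    · rw [← mul_assoc, ← pow_succ]
      exact hxm (k + 1)
  have hle : 2 * x ≤ x := hmax _ hmem
  have := ne_zero_of_mem_pseudoFrobSet hx
  omega

theorem EquiGcd.eq_or_two_mul_eq {S S' : AddSubmonoid ℕ} (h : EquiGcd S S') {m v : ℕ}
    (hm : m ∉ S) (huniq : ∀ k, k ∈ pseudoFrobSet S S' ∧ 2 * k ∈ S → k = m)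
    (hv : v ∈ pseudoFrobSet S S') : v = m ∨ 2 * v = m := by
  obtain ⟨k, hk⟩ := h.exists_two_pow_mul_eq huniq hv
  match k with
  | 0 => exact Or.inl (by simpa using hk)
  | 1 => exact Or.inr (by simpa using hk)
  | k + 2 =>
    exfalso
    have h4v : 4 * v ∉ S := fun h4v => hm <| by
      have hmul := S.nsmul_mem h4v (2 ^ k)
      rwa [smul_eq_mul, ← mul_assoc, show 2 ^ k * 4 = 2 ^ (k + 2) by ring, hk] at hmul
    have h2v : v + v ∉ S := fun h2v => h4v <| by
      convert S.add_mem h2v h2v using 1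
      ring
    have h3v : v + (v + v) ∉ S := fun h3v => h4v <| by
      convert hv.2.2 _ h3v (by have := ne_zero_of_mem_pseudoFrobSet hv; omega) using 1
      ring
    obtain ⟨j, hj⟩ := h.exists_two_pow_mul_eq huniq
      (add_mem_pseudoFrobSet hv (add_mem_pseudoFrobSet hv hv h2v) h3v)
    have hpow : 2 ^ j * 3 = 2 ^ (k + 2) :=
      Nat.eq_of_mul_eq_mul_right (Nat.pos_of_ne_zero (ne_zero_of_mem_pseudoFrobSet hv))
        (by rw [hk, ← hj]; ring)
    have h32 : 3 ∣ 2 := Nat.prime_three.dvd_of_dvd_pow (Dvd.intro_left _ hpow)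
    omega

theorem irreducible_iff_sym_or_pseudosym (S S' : AddSubmonoid ℕ) (hSS' : S ≤ S')
    (hne : S ≠ S') (hgcd : EquiGcd S S') :
    IrreducibleIn S S' ↔
      (∃ w : ℕ, pseudoFrobSet S S' = {w}) ∨
      (∃ v : ℕ, v ≠ 2 * v ∧ pseudoFrobSet S S' = {v, 2 * v}) := by
  rw [irreducibleIn_iff_existsUnique hSS' hne hgcd]
  constructor
  · rintro ⟨m, ⟨hm, -⟩, huniq⟩
    by_cases hv : ∃ v ∈ pseudoFrobSet S S', v ≠ m
    · obtain ⟨v, hv, hvm⟩ := hv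
      obtain rfl := (hgcd.eq_or_two_mul_eq hm.2.1 huniq hv).resolve_left hvm
      refine Or.inr ⟨v, hvm, Set.ext fun x => ⟨fun hx => ?_, ?_⟩⟩
      · rcases hgcd.eq_or_two_mul_eq hm.2.1 huniq hx with rfl | hx
        · exact Or.inr rfl
        · exact Or.inl (by omega)
      · rintro (rfl | rfl)
        exacts [hv, hm]
    · push Not at hv
      exact Or.inl ⟨m, Set.eq_singleton_iff_unique_mem.2 ⟨hm, hv⟩⟩
  · obtain ⟨m, hm, -, h2m⟩ := hgcd.exists_pseudoFrob_mem hSS' le_rfl hne.symm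
    rintro (⟨w, hw⟩ | ⟨v, -, hv⟩)
    · refine ⟨m, ⟨hm, h2m⟩, fun k hk => ?_⟩
      rw [hw] at hm hk
      exact hk.1.trans hm.symm
    · have h2v : 2 * v ∉ S := by
        have hmem : 2 * v ∈ pseudoFrobSet S S' := hv ▸ Or.inr rfl
        exact hmem.2.1
      have huniq : ∀ k, k ∈ pseudoFrobSet S S' ∧ 2 * k ∈ S → k = 2 * v := by
        rintro k ⟨hk, h2k⟩
        rw [hv] at hk
        rcases hk with rfl | rfl
        exacts [absurd h2k h2v, rfl]
      exact ⟨m, ⟨hm, h2m⟩, fun k hk => (huniq k hk).trans (huniq m ⟨hm, h2m⟩).symm⟩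
end

section
/- Let S ≤ S' be additive submonoids of ℕ with the pair (S, S') equi-gcd, and let s ∈ S' \ S. Then FG(S'/S) = {s} if and only if every t ∈ S' \ S is a radical of s, i.e. for every t ∈ S' \ S there exists n ∈ ℕ with n * t = s. -/
/-- For an equi-gcd pair, all sufficiently large elements of `S'` lie in `S`. -/
theorem EquiGcd.exists_forall_ge_mem {S S' : AddSubmonoid ℕ} (h : EquiGcd S S') :
    ∃ N, ∀ m ≥ N, m ∈ S' → m ∈ S := by
  obtain ⟨N, hN⟩ := Nat.exists_mem_closure_of_ge (S : Set ℕ)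
  refine ⟨N, fun m hm hmS' => ?_⟩
  have hdvd : Nat.setGcd (S : Set ℕ) ∣ m :=
    (h _).1 (fun _ hx => Nat.setGcd_dvd_of_mem hx) m hmS'
  simpa using hN m hm hdvd

/-- Every gap of an equi-gcd pair has a multiple that is a fundamental gap. -/
theorem EquiGcd.exists_mul_mem_fundGapSet {S S' : AddSubmonoid ℕ} (h : EquiGcd S S') {t : ℕ}
    (ht : t ∈ S') (ht' : t ∉ S) : ∃ n, n * t ∈ fundGapSet S S' := by
  classical
  have ht0 : 0 < t := Nat.pos_of_ne_zero fun h0 => ht' (h0 ▸ S.zero_mem)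
  have hmul : ∀ n, n * t ∈ S' := fun n => by simpa using S'.nsmul_mem ht n
  obtain ⟨N, hN⟩ := h.exists_forall_ge_mem
  have hbound : ∀ n, n * t ∉ S → n ≤ N := fun n hn => by
    by_contra! hlt
    exact hn (hN _ (by nlinarith) (hmul n))
  have h1 : 1 * t ∉ S := by simpa using ht'
  have hmax : ∀ n, n * t ∉ S → n ≤ Nat.findGreatest (fun n => n * t ∉ S) N :=
    fun n hn => Nat.le_findGreatest (hbound n hn) hn
  have hspec := Nat.findGreatest_spec (P := fun n => n * t ∉ S) (hbound 1 h1) h1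
  have hpos := hmax 1 h1
  set k := Nat.findGreatest (fun n => n * t ∉ S) N
  have hgt : ∀ n, k < n → n * t ∈ S := fun n hn => by
    by_contra hnS
    exact (hmax n hnS).not_gt hn
  refine ⟨k, hmul k, hspec, ?_, ?_⟩
  · rw [← mul_assoc]
    exact hgt _ (by omega)
  · rw [← mul_assoc]
    exact hgt _ (by omega)

/-- A submonoid containing `2 * t` and `3 * t` contains every `n * t` with `2 ≤ n`. -/
theorem AddSubmonoid.mul_mem_of_two_mul_mem_of_three_mul_mem {S : AddSubmonoid ℕ} {t : ℕ}
    (h2 : 2 * t ∈ S) (h3 : 3 * t ∈ S) {n : ℕ} (hn : 2 ≤ n) : n * t ∈ S := by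
  induction n using Nat.strong_induction_on with
  | _ n ih =>
    obtain rfl | rfl | hn4 : n = 2 ∨ n = 3 ∨ 4 ≤ n := by omega
    · exact h2
    · exact h3
    · obtain ⟨m, rfl⟩ := Nat.exists_eq_add_of_le' (show 2 ≤ n by omega)
      rw [add_mul]
      exact S.add_mem (ih m (by omega) (by omega)) h2

theorem single_fund_gap_iff_radicals (S S' : AddSubmonoid ℕ) (hSS' : S ≤ S')
    (hgcd : EquiGcd S S') (s : ℕ) (hs : s ∈ S') (hs' : s ∉ S) :
    fundGapSet S S' = {s} ↔
      ∀ t : ℕ, t ∈ S' → t ∉ S → ∃ n : ℕ, n * t = s := by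
  have hs0 : 0 < s := Nat.pos_of_ne_zero fun h0 => hs' (h0 ▸ S.zero_mem)
  constructor
  · intro hFG t ht ht'
    obtain ⟨n, hn⟩ := hgcd.exists_mul_mem_fundGapSet ht ht'
    rw [hFG] at hn
    exact ⟨n, hn⟩
  · intro hrad
    have hmem : ∀ m, 2 ≤ m → m * s ∈ S := fun m hm => by
      by_contra hmS
      obtain ⟨n, hn⟩ := hrad (m * s) (by simpa using S'.nsmul_mem hs m) hmS
      rcases n.eq_zero_or_pos with rfl | hnpos
      · omega
      · nlinarith [Nat.le_mul_of_pos_left (m * s) hnpos]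
    refine Set.eq_singleton_iff_unique_mem.2
      ⟨⟨hs, hs', hmem 2 le_rfl, hmem 3 (by omega)⟩, ?_⟩
    rintro t ⟨ht, ht', h2, h3⟩
    obtain ⟨n, rfl⟩ := hrad t ht ht'
    obtain rfl | rfl | hn : n = 0 ∨ n = 1 ∨ 2 ≤ n := by omega
    · simp at hs0
    · simp
    · exact absurd (AddSubmonoid.mul_mem_of_two_mul_mem_of_three_mul_mem h2 h3 hn) hs'
end
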